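/- For every p ≥ 1, every bounded domain Ω ⊂ ℝ^d with Lipschitz boundary, and every Lipschitz function f: ℝ^d → ℝ that is constant on Ω^c, it holds osc_Ω(f) ≤ C diam(Ω)^{p/(p+d)} Lip_Ω(f)^{d/(d+p)} ||∇f||_{L^p(Ω)}^{p/(p+d)}, where C depends only on p, d and Ω and is invariant under dilations of Ω. -/

import Mathlib

open MeasureTheory Metric Set Filter
open scoped ENNReal NNReal Topology RealInnerProductSpace Pointwise

noncomputable section

/-- A bounded open set has Lipschitz boundary if near each boundary point it is, in a
suitable direction, the region above the graph of a Lipschitz function. -/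
def HasLipschitzBoundary {d : ℕ} (Ω : Set (EuclideanSpace ℝ (Fin d))) : Prop :=
  ∀ x ∈ frontier Ω, ∃ v : EuclideanSpace ℝ (Fin d), ‖v‖ = 1 ∧
    ∃ r > (0 : ℝ), ∃ (K : ℝ≥0) (f : EuclideanSpace ℝ (Fin d) → ℝ), LipschitzWith K f ∧
      ∀ y ∈ ball x r, (y ∈ Ω ↔ f (y - ⟪y, v⟫ • v) < ⟪y, v⟫)

/-- oscillation of `f` on `Ω`. -/
def oscOn {X : Type*} (Ω : Set X) (f : X → ℝ) : ℝ := sSup (f '' Ω) - sInf (f '' Ω)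

lemma exists_first_notMem {U : Set ℝ} (hU : IsOpen U) {s : ℝ} (h0 : (0 : ℝ) ∈ U) (hs : 0 < s)
    (hsU : s ∉ U) : ∃ T, 0 < T ∧ T ≤ s ∧ T ∉ U ∧ ∀ τ, 0 ≤ τ → τ < T → τ ∈ U := by
  obtain ⟨T, ⟨⟨hT0, hTs⟩, hTU⟩, hT⟩ :=
    (isCompact_Icc.diff hU : IsCompact (Icc 0 s \ U)).exists_isLeast ⟨s, ⟨hs.le, le_rfl⟩, hsU⟩
  refine ⟨T, hT0.lt_of_ne (by rintro rfl; exact hTU h0), hTs, hTU, fun τ h1 h2 => ?_⟩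
  by_contra h
  exact absurd (hT ⟨⟨h1, h2.le.trans hTs⟩, h⟩) (not_le.2 h2)

section Lipschitz

variable {E : Type*} [NormedAddCommGroup E] [NormedSpace ℝ E]

lemma abs_le_mul_dist_of_eq_zero_off {Ω : Set E} (hΩ : IsOpen Ω) {g : E → ℝ} (hg : Continuous g)
    (h0 : ∀ x ∉ Ω, g x = 0) {L : ℝ} (hL : 0 ≤ L)
    (hLip : ∀ x ∈ Ω, ∀ y ∈ Ω, |g x - g y| ≤ L * dist x y) {x y : E} (hx : x ∈ Ω) (hy : y ∉ Ω) :
    |g x| ≤ L * dist x y := by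
  set γ : ℝ → E := ⇑(AffineMap.lineMap x y : ℝ →ᵃ[ℝ] E) with hγ
  have hγc : Continuous γ := AffineMap.lineMap_continuous
  obtain ⟨T, hT0, hT1, hTU, hT⟩ := exists_first_notMem (hΩ.preimage hγc) (s := 1)
    (by simpa [γ] using hx) one_pos (by simpa [γ] using hy)
  have hcl : IsClosed {τ : ℝ | |g x - g (γ τ)| ≤ L * dist x (γ τ)} :=
    isClosed_le (by fun_prop) (by fun_prop)
  have hsub : Ico 0 T ⊆ {τ : ℝ | |g x - g (γ τ)| ≤ L * dist x (γ τ)} :=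
    fun τ hτ => hLip x hx _ (hT τ hτ.1 hτ.2)
  have hmem := closure_minimal hsub hcl
    (by rw [closure_Ico hT0.ne]; exact ⟨hT0.le, le_rfl⟩ : T ∈ closure (Ico 0 T))
  have hz : g (γ T) = 0 := h0 _ hTU
  have hd : dist x (γ T) ≤ dist x y := by
    rw [hγ, dist_left_lineMap, Real.norm_eq_abs, abs_of_pos hT0]
    exact mul_le_of_le_one_left dist_nonneg hT1
  simp only [mem_ofPred_eq, hz, sub_zero] at hmem
  exact hmem.trans (by gcongr)

lemma lipschitzWith_of_eq_zero_off {Ω : Set E} (hΩ : IsOpen Ω) {g : E → ℝ} (hg : Continuous g)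
    (h0 : ∀ x ∉ Ω, g x = 0) {L : ℝ} (hL : 0 ≤ L)
    (hLip : ∀ x ∈ Ω, ∀ y ∈ Ω, |g x - g y| ≤ L * dist x y) : LipschitzWith L.toNNReal g := by
  refine LipschitzWith.of_dist_le_mul fun x y => ?_
  rw [Real.coe_toNNReal _ hL, Real.dist_eq]
  by_cases hx : x ∈ Ω <;> by_cases hy : y ∈ Ω
  · exact hLip x hx y hy
  · simpa [h0 y hy] using abs_le_mul_dist_of_eq_zero_off hΩ hg h0 hL hLip hx hy
  · simpa [h0 x hx, dist_comm x y] using abs_le_mul_dist_of_eq_zero_off hΩ hg h0 hL hLip hy hx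
  · simp only [h0 x hx, h0 y hy, sub_zero, abs_zero]; positivity

end Lipschitz

lemma enorm_le_setLIntegral_deriv {U : Set ℝ} (hU : IsOpen U) {h : ℝ → ℝ} {K : ℝ≥0}
    (hh : LipschitzWith K h) (h0 : ∀ τ ∉ U, h τ = 0) {s : ℝ} (hs : 0 < s) (hsU : s ∉ U) :
    ‖h 0‖ₑ ≤ ∫⁻ τ in Ioc 0 s, U.indicator (fun τ => ‖deriv h τ‖ₑ) τ := by
  by_cases h0U : (0 : ℝ) ∈ U
  swap
  · simp [h0 0 h0U]
  obtain ⟨T, hT0, hTs, hTU, hT⟩ := exists_first_notMem hU h0U hs hsU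
  have hac : AbsolutelyContinuousOnInterval h 0 T :=
    (hh.lipschitzOnWith (s := uIcc 0 T)).absolutelyContinuousOnInterval
  have hint := hac.integral_deriv_eq_sub
  rw [h0 T hTU, zero_sub, intervalIntegral.integral_of_le hT0.le] at hint
  calc ‖h 0‖ₑ = ‖∫ τ in Ioc 0 T, deriv h τ‖ₑ := by rw [hint, enorm_neg]
    _ ≤ ∫⁻ τ in Ioc 0 T, ‖deriv h τ‖ₑ := enorm_integral_le_lintegral_enorm _
    _ = ∫⁻ τ in Ioo 0 T, ‖deriv h τ‖ₑ := setLIntegral_congr Ioo_ae_eq_Ioc.symm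
    _ = ∫⁻ τ in Ioo 0 T, U.indicator (fun τ => ‖deriv h τ‖ₑ) τ :=
        setLIntegral_congr_fun measurableSet_Ioo fun τ hτ => by
          simp [indicator_of_mem (hT τ hτ.1.le hτ.2)]
    _ ≤ _ := lintegral_mono_set (Ioo_subset_Ioc_self.trans (Ioc_subset_Ioc_right hTs))

lemma rpow_lintegral_Ioc_le {p : ℝ} (hp : 1 ≤ p) {s : ℝ} (F : ℝ → ℝ≥0∞) (hF : Measurable F) :
    (∫⁻ τ in Ioc 0 s, F τ) ^ p ≤ ENNReal.ofReal s ^ (p - 1) * ∫⁻ τ in Ioc 0 s, F τ ^ p := by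
  have hp0 : 0 < p := one_pos.trans_le hp
  have key : ∫⁻ τ in Ioc 0 s, F τ ≤
      (∫⁻ τ in Ioc 0 s, F τ ^ p) ^ (1 / p) * ENNReal.ofReal s ^ (1 - 1 / p) := by
    rcases hp.eq_or_lt with rfl | hp1
    · simp
    have hpq := Real.HolderConjugate.conjExponent hp1
    have := ENNReal.lintegral_mul_le_Lp_mul_Lq (volume.restrict (Ioc 0 s)) hpq
      hF.aemeasurable (aemeasurable_const (b := (1 : ℝ≥0∞)))
    simp only [Pi.mul_apply, mul_one, ENNReal.one_rpow, lintegral_const, one_mul,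
      Measure.restrict_apply_univ, Real.volume_Ioc, sub_zero] at this
    convert this using 3
    rw [one_div, one_div, hpq.one_sub_inv]
  calc (∫⁻ τ in Ioc 0 s, F τ) ^ p
      ≤ ((∫⁻ τ in Ioc 0 s, F τ ^ p) ^ (1 / p) * ENNReal.ofReal s ^ (1 - 1 / p)) ^ p := by gcongr
    _ = _ := by
      rw [ENNReal.mul_rpow_of_nonneg _ _ hp0.le, ← ENNReal.rpow_mul, ← ENNReal.rpow_mul,
        one_div_mul_cancel hp0.ne', ENNReal.rpow_one, mul_comm]
      congr 2
      field_simp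

section Poincare

variable {E : Type*} [NormedAddCommGroup E] [NormedSpace ℝ E] [FiniteDimensional ℝ E]
  [MeasurableSpace E] [BorelSpace E] (μ : Measure E) [μ.IsAddHaarMeasure]

/-- Poincaré's inequality for Lipschitz functions vanishing off an open set of bounded width. -/
lemma lintegral_rpow_le_of_eq_zero_off {p : ℝ} (hp : 1 ≤ p) {Ω : Set E} (hΩ : IsOpen Ω)
    {g : E → ℝ} {K : ℝ≥0} (hg : LipschitzWith K g) (h0 : ∀ x ∉ Ω, g x = 0) {s : ℝ} (hs : 0 < s)
    {e : E} (he : ‖e‖ = 1) (hout : ∀ x ∈ Ω, x + s • e ∉ Ω) :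
    ∫⁻ x, ‖g x‖ₑ ^ p ∂μ ≤ ENNReal.ofReal s ^ p * ∫⁻ x in Ω, ‖fderiv ℝ g x‖ₑ ^ p ∂μ := by
  have hp0 : 0 < p := one_pos.trans_le hp
  set G : E → ℝ≥0∞ := Ω.indicator fun x => ‖fderiv ℝ g x‖ₑ
  have hGm : Measurable G := (measurable_fderiv ℝ g).enorm.indicator hΩ.measurableSet
  have hae : ∀ᵐ x ∂μ, ∀ᵐ τ : ℝ, DifferentiableAt ℝ g (x + τ • e) := by
    have hm : MeasurableSet {z : ℝ × E | DifferentiableAt ℝ g (z.2 + z.1 • e)} :=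
      (measurableSet_of_differentiableAt ℝ g).preimage (by fun_prop)
    have h1 : ∀ᵐ z : ℝ × E ∂(volume.prod μ), DifferentiableAt ℝ g (z.2 + z.1 • e) := by
      rw [Measure.ae_prod_iff_ae_ae hm]
      refine Eventually.of_forall fun τ => ?_
      exact (measurePreserving_add_right μ (τ • e)).quasiMeasurePreserving.ae hg.ae_differentiableAt
    exact Measure.ae_ae_comm (p := fun τ x => DifferentiableAt ℝ g (x + τ • e)) hm |>.1
      ((Measure.ae_prod_iff_ae_ae hm).1 h1)
  have hpt : ∀ᵐ x ∂μ, ‖g x‖ₑ ^ p ≤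
      ENNReal.ofReal s ^ (p - 1) * ∫⁻ τ in Ioc 0 s, G (x + τ • e) ^ p := by
    filter_upwards [hae] with x hx
    by_cases hxΩ : x ∈ Ω
    swap
    · simp [h0 x hxΩ, hp0]
    have hline : LipschitzWith 1 fun τ : ℝ => x + τ • e :=
      LipschitzWith.of_dist_le_mul fun a b => by
        simp [dist_eq_norm, ← sub_smul, norm_smul, he]
    have hle := enorm_le_setLIntegral_deriv (hΩ.preimage hline.continuous) (hg.comp hline)
      (fun τ hτ => h0 _ hτ) hs (hout x hxΩ)
    refine le_trans ?_ (rpow_lintegral_Ioc_le hp (fun τ => G (x + τ • e))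
      (hGm.comp hline.continuous.measurable))
    gcongr
    refine le_trans (by simpa using hle) (lintegral_mono_ae (ae_restrict_of_ae ?_))
    filter_upwards [hx] with τ hτ
    by_cases hτΩ : x + τ • e ∈ Ω
    swap
    · simp [indicator, hτΩ]
    have hd : HasDerivAt (g ∘ fun τ : ℝ => x + τ • e) (fderiv ℝ g (x + τ • e) e) τ := by
      refine hτ.hasFDerivAt.comp_hasDerivAt τ ?_
      simpa using ((hasDerivAt_id τ).smul_const e).const_add x
    simp only [indicator, mem_preimage, hτΩ, if_true, G, hd.deriv]
    rw [← ofReal_norm, ← ofReal_norm]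
    gcongr
    simpa [he] using (fderiv ℝ g (x + τ • e)).le_opNorm e
  have hGp : ∫⁻ x, G x ^ p ∂μ = ∫⁻ x in Ω, ‖fderiv ℝ g x‖ₑ ^ p ∂μ := by
    rw [← lintegral_indicator hΩ.measurableSet]
    refine lintegral_congr fun x => ?_
    by_cases hx : x ∈ Ω <;> simp [G, hx, hp0]
  calc ∫⁻ x, ‖g x‖ₑ ^ p ∂μ
      ≤ ∫⁻ x, ENNReal.ofReal s ^ (p - 1) * (∫⁻ τ in Ioc 0 s, G (x + τ • e) ^ p) ∂μ :=
        lintegral_mono_ae hpt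
    _ = ENNReal.ofReal s ^ (p - 1) * ∫⁻ x, (∫⁻ τ in Ioc 0 s, G (x + τ • e) ^ p) ∂μ :=
        lintegral_const_mul' _ _ (ENNReal.rpow_ne_top_of_nonneg (by linarith) ENNReal.ofReal_ne_top)
    _ = ENNReal.ofReal s ^ (p - 1) * ∫⁻ τ in Ioc 0 s, ∫⁻ x, G (x + τ • e) ^ p ∂μ := by
        rw [lintegral_lintegral_swap]
        exact ((hGm.comp (by fun_prop :
          Measurable fun z : E × ℝ => z.1 + z.2 • e)).pow_const p).aemeasurable
    _ = ENNReal.ofReal s ^ (p - 1) * (ENNReal.ofReal s * ∫⁻ x, G x ^ p ∂μ) := by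
        simp_rw [lintegral_add_right_eq_self (μ := μ) (fun x => G x ^ p)]
        simp [mul_comm]
    _ = _ := by
        rw [hGp, ← mul_assoc]
        congr 1
        nth_rw 2 [← ENNReal.rpow_one (ENNReal.ofReal s)]
        rw [← ENNReal.rpow_add _ _ (by simpa using hs) ENNReal.ofReal_ne_top, sub_add_cancel]

end Poincare

lemma mul_volume_ball_le_lintegral {d : ℕ} {p : ℝ} (hp : 0 ≤ p)
    {g : EuclideanSpace ℝ (Fin d) → ℝ} {L : ℝ} (hL : 0 < L) (hg : LipschitzWith L.toNNReal g)
    (x : EuclideanSpace ℝ (Fin d)) :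
    ENNReal.ofReal (|g x| / 2) ^ p * volume (ball x (|g x| / (2 * L))) ≤ ∫⁻ y, ‖g y‖ₑ ^ p := by
  calc _ = ∫⁻ _ in ball x (|g x| / (2 * L)), ENNReal.ofReal (|g x| / 2) ^ p := by simp
    _ ≤ ∫⁻ y in ball x (|g x| / (2 * L)), ‖g y‖ₑ ^ p := by
        refine setLIntegral_mono' measurableSet_ball fun y hy => ?_
        gcongr
        rw [← ofReal_norm]
        apply ENNReal.ofReal_le_ofReal
        have h1 := hg.dist_le_mul x y
        rw [Real.coe_toNNReal _ hL.le, Real.dist_eq] at h1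
        have h2 : L * dist x y ≤ |g x| / 2 := by
          rw [mem_ball, dist_comm, lt_div_iff₀ (by positivity)] at hy
          linarith
        have h3 := abs_sub_abs_le_abs_sub (g x) (g y)
        rw [Real.norm_eq_abs]
        linarith
    _ ≤ _ := setLIntegral_le_lintegral _ _

lemma rpow_mul_measureReal_ball_le {d : ℕ} (hd : d ≠ 0) {p : ℝ} (hp : 1 ≤ p)
    {Ω : Set (EuclideanSpace ℝ (Fin d))} (hΩ : IsOpen Ω) (hbdd : Bornology.IsBounded Ω)
    (hne : Ω.Nonempty) {g : EuclideanSpace ℝ (Fin d) → ℝ} {L : ℝ} (hL : 0 < L)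
    (hg : LipschitzWith L.toNNReal g) (h0 : ∀ x ∉ Ω, g x = 0) {x : EuclideanSpace ℝ (Fin d)}
    (hx : g x ≠ 0) :
    (|g x| / 2) ^ (p + d) * volume.real (ball (0 : EuclideanSpace ℝ (Fin d)) 1) ≤
      L ^ (d : ℝ) * ((2 * diam Ω) ^ p * ∫ y in Ω, ‖fderiv ℝ g y‖ ^ p) := by
  have hp0 : 0 < p := one_pos.trans_le hp
  have : NeZero d := ⟨hd⟩
  have hm : 0 < |g x| := abs_pos.2 hx
  set e : EuclideanSpace ℝ (Fin d) := EuclideanSpace.single 0 1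
  have hen : ‖e‖ = 1 := by simp [e]
  have hdiam : 0 < diam Ω := by
    obtain ⟨y, hy⟩ := hne
    obtain ⟨ε, hε, hεb⟩ := Metric.isOpen_iff.1 hΩ y hy
    have hmem : y + (ε / 2) • e ∈ Ω :=
      hεb (by simp [norm_smul, hen, abs_of_pos hε, hε])
    have := dist_le_diam_of_mem hbdd hmem hy
    rw [dist_eq_norm, add_sub_cancel_left, norm_smul, hen, mul_one, Real.norm_eq_abs] at this
    exact (abs_pos.2 (by positivity)).trans_le this
  have hout : ∀ y ∈ Ω, y + (2 * diam Ω) • e ∉ Ω := fun y hy hmem => by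
    have := dist_le_diam_of_mem hbdd hmem hy
    rw [dist_eq_norm, add_sub_cancel_left, norm_smul, hen, mul_one, Real.norm_eq_abs,
      abs_of_pos (by positivity)] at this
    linarith
  have h1 := (mul_volume_ball_le_lintegral hp0.le hL hg x).trans
    (lintegral_rpow_le_of_eq_zero_off volume hp hΩ hg h0 (by positivity : 0 < 2 * diam Ω) hen hout)
  have hfin : ∫⁻ y in Ω, ‖fderiv ℝ g y‖ₑ ^ p ≠ ⊤ := by
    refine ((setLIntegral_lt_top_of_le_nnreal hbdd.measure_lt_top.ne
      ⟨L.toNNReal ^ p, fun y _ => ?_⟩)).ne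
    rw [ENNReal.coe_rpow_of_nonneg _ hp0.le]
    gcongr
    rw [← enorm_norm]
    exact_mod_cast (by
      simpa [← NNReal.coe_le_coe] using norm_fderiv_le_of_lipschitz ℝ hg (x₀ := y))
  have hint : ∫ y in Ω, ‖fderiv ℝ g y‖ ^ p = (∫⁻ y in Ω, ‖fderiv ℝ g y‖ₑ ^ p).toReal := by
    rw [integral_eq_lintegral_of_nonneg_ae (Eventually.of_forall fun y => by positivity)
      ((measurable_fderiv ℝ g).norm.pow_const p).aestronglyMeasurable]
    congr 1
    refine lintegral_congr fun y => ?_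
    rw [← ENNReal.ofReal_rpow_of_nonneg (norm_nonneg _) hp0.le, ofReal_norm]
  have h2 := ENNReal.toReal_mono (ENNReal.mul_ne_top
    (ENNReal.rpow_ne_top_of_nonneg hp0.le ENNReal.ofReal_ne_top) hfin) h1
  rw [ENNReal.toReal_mul, ENNReal.toReal_mul, ← hint, Measure.addHaar_ball_of_pos _ _ (by positivity),
    ENNReal.toReal_mul, ← ENNReal.toReal_rpow, ← ENNReal.toReal_rpow,
    ENNReal.toReal_ofReal (by positivity), ENNReal.toReal_ofReal (by positivity),
    ENNReal.toReal_ofReal (by positivity), finrank_euclideanSpace_fin] at h2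
  calc _ = L ^ (d : ℝ) * ((|g x| / 2) ^ p * ((|g x| / (2 * L)) ^ d *
        volume.real (ball (0 : EuclideanSpace ℝ (Fin d)) 1))) := by
        rw [Real.rpow_add (by positivity), Real.rpow_natCast, Real.rpow_natCast, ← div_div, div_pow _ L]
        field_simp
    _ ≤ _ := mul_le_mul_of_nonneg_left h2 (by positivity)

lemma oscOn_le_two_mul {X : Type*} {Ω : Set X} (hne : Ω.Nonempty) {f : X → ℝ} {c B : ℝ}
    (h : ∀ x ∈ Ω, |f x - c| ≤ B) : oscOn Ω f ≤ 2 * B := by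
  have h1 : sSup (f '' Ω) ≤ c + B := csSup_le (hne.image f) (by
    rintro _ ⟨x, hx, rfl⟩
    linarith [(abs_le.1 (h x hx)).2])
  have h2 : c - B ≤ sInf (f '' Ω) := le_csInf (hne.image f) (by
    rintro _ ⟨x, hx, rfl⟩
    linarith [(abs_le.1 (h x hx)).1])
  unfold oscOn
  linarith

/-- Lemma 2.2, interpolation inequality: for every `p ≥ 1` and every
bounded Lipschitz domain `Ω₀ ⊂ ℝ^d` there is `C = C(p,d,Ω₀)`, invariant under dilations,
such that for every dilation `Ω = t • Ω₀` and every Lipschitz `f : ℝ^d → ℝ` constant on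
`Ω^c`, whose Lipschitz constant on `Ω` is at most `L`,
`osc_Ω(f) ≤ C diam(Ω)^{p/(p+d)} L^{d/(d+p)} ‖∇f‖_{L^p(Ω)}^{p/(p+d)}`. -/
theorem gagliardo_nirenberg_interpolation
    (d : ℕ) (p : ℝ) (hp : 1 ≤ p)
    (Ω₀ : Set (EuclideanSpace ℝ (Fin d)))
    (h₀open : IsOpen Ω₀) (h₀conn : IsConnected Ω₀) (h₀bdd : Bornology.IsBounded Ω₀)
    (h₀lip : HasLipschitzBoundary Ω₀) :
    ∃ C : ℝ, 0 < C ∧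
    ∀ t : ℝ, 0 < t → ∀ Ω : Set (EuclideanSpace ℝ (Fin d)), Ω = t • Ω₀ →
    ∀ f : EuclideanSpace ℝ (Fin d) → ℝ, (∃ K, LipschitzWith K f) →
      (∃ c₀ : ℝ, ∀ x ∉ Ω, f x = c₀) →
    ∀ L : ℝ, 0 ≤ L → (∀ x ∈ Ω, ∀ y ∈ Ω, |f x - f y| ≤ L * dist x y) →
      oscOn Ω f ≤
        C * diam Ω ^ (p / (p + d)) * L ^ ((d : ℝ) / (d + p)) *
          ((∫ x in Ω, ‖gradient f x‖ ^ p) ^ (1 / p)) ^ (p / (p + d)) := by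
  have hp0 : 0 < p := one_pos.trans_le hp
  set ω := volume.real (ball (0 : EuclideanSpace ℝ (Fin d)) 1) with hω
  have hω0 : 0 < ω := ENNReal.toReal_pos (measure_ball_pos _ _ one_pos).ne' measure_ball_lt_top.ne
  have hq : 0 < p + (d : ℝ) := by positivity
  refine ⟨4 * (2 ^ p / ω) ^ (1 / (p + d)), by positivity, ?_⟩
  rintro t ht Ω rfl f ⟨K, hK⟩ ⟨c, hc⟩ L hL hLip
  set Ω := t • Ω₀
  have hΩ : IsOpen Ω := h₀open.smul₀ ht.ne'
  have hbdd : Bornology.IsBounded Ω := h₀bdd.smul₀ t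
  have hne : Ω.Nonempty := h₀conn.nonempty.smul_set
  have hI : 0 ≤ ∫ x in Ω, ‖gradient f x‖ ^ p := integral_nonneg fun x => by positivity
  have hR : 0 ≤ (2 ^ p / ω) ^ (1 / (p + d)) * diam Ω ^ (p / (p + d)) * L ^ ((d : ℝ) / (d + p)) *
      ((∫ x in Ω, ‖gradient f x‖ ^ p) ^ (1 / p)) ^ (p / (p + d)) := by
    have := diam_nonneg (s := Ω)
    positivity
  rcases eq_or_ne d 0 with rfl | hd
  · refine (oscOn_le_two_mul hne (c := f 0) (B := 0) fun x _ => ?_).trans (by linarith)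
    simp [Subsingleton.elim x 0]
  have hg := lipschitzWith_of_eq_zero_off hΩ (g := fun x => f x - c)
    (hK.continuous.sub continuous_const) (fun x hx => by simp [hc x hx]) hL (by simpa using hLip)
  have hgrad : ∀ x, ‖fderiv ℝ (fun x => f x - c) x‖ = ‖gradient f x‖ := fun x => by
    rw [fderiv_sub_const, gradient, LinearIsometryEquiv.norm_map]
  refine (oscOn_le_two_mul hne (c := c) (B := 2 * _) fun x hx => ?_).trans
    (le_of_eq (by ring : 2 * (2 * ((2 ^ p / ω) ^ (1 / (p + d)) * diam Ω ^ (p / (p + d)) *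
      L ^ ((d : ℝ) / (d + p)) *
      ((∫ x in Ω, ‖gradient f x‖ ^ p) ^ (1 / p)) ^ (p / (p + d)))) = _))
  rcases eq_or_ne (f x - c) 0 with hz | hz
  · rw [hz, abs_zero]
    positivity
  rcases hL.eq_or_lt with rfl | hL0
  · have : NeZero d := ⟨hd⟩
    obtain ⟨y, hy⟩ : ∃ y, y ∉ Ω := by
      by_contra! h
      exact NormedSpace.unbounded_univ ℝ (EuclideanSpace ℝ (Fin d)) (eq_univ_of_forall h ▸ hbdd)
    have := hg.dist_le_mul x y
    simp only [Real.dist_eq, hc y hy, sub_self, sub_zero, Real.toNNReal_zero, NNReal.coe_zero,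
      zero_mul] at this
    exact absurd (abs_nonpos_iff.1 this) hz
  have key := rpow_mul_measureReal_ball_le hd hp hΩ hbdd hne hL0 hg
    (fun y hy => by simp [hc y hy]) hz
  simp_rw [hgrad] at key
  rw [← hω, ← le_div_iff₀ hω0] at key
  have hD := diam_nonneg (s := Ω)
  set I := ∫ x in Ω, ‖gradient f x‖ ^ p
  have h3 := Real.rpow_le_rpow (by positivity) key (by positivity : 0 ≤ 1 / (p + (d : ℝ)))
  rw [← Real.rpow_mul (by positivity), mul_one_div_cancel hq.ne', Real.rpow_one] at h3
  suffices h4 : (L ^ (d : ℝ) * ((2 * diam Ω) ^ p * I) / ω) ^ (1 / (p + (d : ℝ))) =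
      (2 ^ p / ω) ^ (1 / (p + d)) * diam Ω ^ (p / (p + d)) * L ^ ((d : ℝ) / (d + p)) *
        (I ^ (1 / p)) ^ (p / (p + d)) by
    rw [← h4]
    linarith
  rw [Real.mul_rpow two_pos.le hD,
    show L ^ (d : ℝ) * (2 ^ p * diam Ω ^ p * I) / ω =
      2 ^ p / ω * diam Ω ^ p * L ^ (d : ℝ) * I by ring,
    Real.mul_rpow (by positivity) hI, Real.mul_rpow (by positivity) (by positivity),
    Real.mul_rpow (by positivity) (by positivity), ← Real.rpow_mul hD, ← Real.rpow_mul hL,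
    ← Real.rpow_mul hI, add_comm (d : ℝ) p, mul_one_div, mul_one_div,
    one_div_mul_eq_div p, div_div_cancel_left' hp0.ne', one_div]

end
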